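/- arXiv:2210.07434 — 5 statements merged into one kernel-verified Lean document; each statement's English description precedes it below -/
import Mathlib

section
/- Fix N, a positive even integer m, π ∈ P₂(m) and σ⃗ = (σ_1,…,σ_m) ∈ S([N]²)^m. If B ⊆ [m] and k ∈ B, then 𝔞_{π,σ⃗}(B ∪ {k−1}) ≤ 𝔞_{π,σ⃗}(B) and 𝔞_{π,σ⃗}(B ∪ {k+1}) ≤ 𝔞_{π,σ⃗}(B), where k−1 and k+1 are taken cyclically in [m]. In particular 𝔞_{π,σ⃗}(B) ≥ 𝔞_{π,σ⃗} for every nonempty B ⊆ [m]. -/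
open Finset

/-- The set `A_{π,σ⃗}` of admissible index tuples `(i_s, j_s)_{s ∈ [m]}`:
cyclically `j_k = i_{k+1}` (which encodes both `j_k = i_{k+1}` for `k < m` and `i_1 = j_m`),
and `σ_k(i_k,j_k) = ⊤(σ_{π k}(i_{π k}, j_{π k}))` for all `k`. -/
def Afull (N m : ℕ) [NeZero m] (π : Equiv.Perm (Fin m))
    (σv : Fin m → Equiv.Perm (Fin N × Fin N)) : Finset (Fin m → Fin N × Fin N) :=
  Finset.univ.filter (fun v =>
    (∀ k, (v k).2 = (v (k + 1)).1) ∧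
    (∀ k, σv k (v k) = Prod.swap (σv (π k) (v (π k)))))

/-- `A_{π,σ⃗}(B)`: tuples indexed by `B` that extend to an element of `A_{π,σ⃗}`. -/
def Ares (N m : ℕ) [NeZero m] (π : Equiv.Perm (Fin m))
    (σv : Fin m → Equiv.Perm (Fin N × Fin N)) (B : Finset (Fin m)) :
    Finset ({k // k ∈ B} → Fin N × Fin N) :=
  (Afull N m π σv).image (fun v k => v k.1)

/-- `|{(k,l) ∈ B × B : π k = l}|`, the quantity `|B²|_π`. -/
def cpair (m : ℕ) (π : Equiv.Perm (Fin m)) (B : Finset (Fin m)) : ℕ :=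
  (Finset.univ.filter (fun kl : Fin m × Fin m =>
    kl.1 ∈ B ∧ kl.2 ∈ B ∧ π kl.1 = kl.2)).card

theorem Finset.card_image_le_card_image_mul_card {α β γ δ : Type*} [DecidableEq β]
    [DecidableEq γ] [Fintype δ] (s : Finset α) (f : α → β) (g : α → γ) (h : α → δ)
    (hfgh : ∀ v ∈ s, ∀ w ∈ s, g v = g w → h v = h w → f v = f w) :
    (s.image f).card ≤ (s.image g).card * Fintype.card δ := by
  classical
  obtain rfl | ⟨x₀, -⟩ := s.eq_empty_or_nonempty
  · simp
  have : Nonempty α := ⟨x₀⟩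
  have hpre : ∀ y ∈ s.image f, ∃ x ∈ s, f x = y := fun y hy => by simpa using hy
  choose! r hr hfr using hpre
  rw [← Finset.card_univ, ← Finset.card_product]
  refine Finset.card_le_card_of_injOn (fun y => (g (r y), h (r y))) ?_ ?_
  · intro y hy
    exact Finset.mem_product.2 ⟨Finset.mem_image_of_mem g (hr y hy), Finset.mem_univ _⟩
  · intro y hy z hz hyz
    obtain ⟨hg, hh⟩ := Prod.ext_iff.1 hyz
    rw [← hfr y hy, ← hfr z hz]
    exact hfgh _ (hr y hy) _ (hr z hz) hg hh

theorem cpair_eq_card_filter {m : ℕ} (π : Equiv.Perm (Fin m)) (B : Finset (Fin m)) :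
    cpair m π B = (B.filter fun k => π k ∈ B).card := by
  refine Finset.card_bij' (fun kl _ => kl.1) (fun k _ => (k, π k)) ?_ ?_ ?_ ?_ <;>
    simp +contextual

theorem cpair_insert_of_apply_notMem {m : ℕ} {π : Equiv.Perm (Fin m)}
    (hπinv : ∀ k, π (π k) = k) (hπfix : ∀ k, π k ≠ k) {B : Finset (Fin m)} {l : Fin m}
    (h : π l ∉ B) : cpair m π (insert l B) = cpair m π B := by
  rw [cpair_eq_card_filter, cpair_eq_card_filter]
  congr 1
  ext x
  have := hπinv x
  have := hπfix l
  simp only [Finset.mem_filter, Finset.mem_insert]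
  grind

theorem cpair_insert_of_apply_mem {m : ℕ} {π : Equiv.Perm (Fin m)}
    (hπinv : ∀ k, π (π k) = k) {B : Finset (Fin m)} {l : Fin m}
    (hl : l ∉ B) (h : π l ∈ B) : cpair m π (insert l B) = cpair m π B + 2 := by
  rw [cpair_eq_card_filter, cpair_eq_card_filter]
  have hins : ((insert l B).filter fun k => π k ∈ insert l B) =
      insert l (insert (π l) (B.filter fun k => π k ∈ B)) := by
    ext x
    have := hπinv x
    have := hπinv l
    simp only [Finset.mem_filter, Finset.mem_insert]
    grind
  rw [hins, Finset.card_insert_of_notMem, Finset.card_insert_of_notMem]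
  · simp [hπinv, hl]
  · have : l ≠ π l := fun e => hl (e ▸ h)
    simp [hl, this]

theorem cpair_univ {m : ℕ} (π : Equiv.Perm (Fin m)) : cpair m π Finset.univ = m := by
  simp [cpair_eq_card_filter]

theorem card_Ares_insert_le {N m : ℕ} [NeZero m] {π : Equiv.Perm (Fin m)}
    {σv : Fin m → Equiv.Perm (Fin N × Fin N)} {B : Finset (Fin m)} {l : Fin m}
    {δ : Type*} [Fintype δ] (h : (Fin m → Fin N × Fin N) → δ)
    (hext : ∀ v ∈ Afull N m π σv, ∀ w ∈ Afull N m π σv,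
      (∀ k ∈ B, v k = w k) → h v = h w → v l = w l) :
    (Ares N m π σv (insert l B)).card ≤ (Ares N m π σv B).card * Fintype.card δ := by
  refine Finset.card_image_le_card_image_mul_card _ _ _ h fun v hv w hw hB hh => ?_
  have hB' : ∀ k ∈ B, v k = w k := fun k hk => congrFun hB ⟨k, hk⟩
  funext ⟨k, hk⟩
  rcases Finset.mem_insert.1 hk with rfl | hk
  exacts [hext v hv w hw hB' hh, hB' k hk]

theorem card_Ares_insert_mul_pow_le {N m : ℕ} [NeZero m] {π : Equiv.Perm (Fin m)}
    (hπinv : ∀ k, π (π k) = k) (hπfix : ∀ k, π k ≠ k)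
    {σv : Fin m → Equiv.Perm (Fin N × Fin N)} {B : Finset (Fin m)} {l : Fin m}
    (h : (Fin m → Fin N × Fin N) → Fin N)
    (hext : ∀ v ∈ Afull N m π σv, ∀ w ∈ Afull N m π σv,
      (∀ k ∈ B, v k = w k) → h v = h w → v l = w l) :
    (Ares N m π σv (insert l B)).card * N ^ (B.card + cpair m π (insert l B) / 2)
      ≤ (Ares N m π σv B).card * N ^ ((insert l B).card + cpair m π B / 2) := by
  by_cases hl : l ∈ B
  · rw [Finset.insert_eq_of_mem hl]
  rw [Finset.card_insert_of_notMem hl]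
  by_cases hπl : π l ∈ B
  · rw [cpair_insert_of_apply_mem hπinv hl hπl, Nat.add_div_right _ two_pos,
      show B.card + (cpair m π B / 2 + 1) =
        B.card + 1 + cpair m π B / 2 by omega]
    refine Nat.mul_le_mul_right _ ?_
    have hcard := card_Ares_insert_le (N := N) (π := π) (σv := σv) (B := B) (l := l)
      (fun _ => ()) fun v hv w hw hB _ => by
        have hv' := (Finset.mem_filter.1 hv).2.2 l
        have hw' := (Finset.mem_filter.1 hw).2.2 l
        rw [hB _ hπl, ← hw'] at hv'
        exact (σv l).injective hv'
    simpa using hcard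
  · rw [cpair_insert_of_apply_notMem hπinv hπfix hπl]
    have hcard := card_Ares_insert_le h hext
    rw [Fintype.card_fin] at hcard
    calc _ ≤ _ := Nat.mul_le_mul_right _ hcard
      _ = _ := by ring

theorem card_Ares_univ {N m : ℕ} [NeZero m] (π : Equiv.Perm (Fin m))
    (σv : Fin m → Equiv.Perm (Fin N × Fin N)) :
    (Ares N m π σv Finset.univ).card = (Afull N m π σv).card :=
  Finset.card_image_of_injective _ fun _ _ hvw =>
    funext fun k => congrFun hvw ⟨k, Finset.mem_univ k⟩

open Fin.CommRing in
theorem Fin.eq_univ_of_add_one_mem {m : ℕ} [NeZero m] {B : Finset (Fin m)}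
    (hne : B.Nonempty) (hB : ∀ k ∈ B, k + 1 ∈ B) : B = Finset.univ := by
  obtain ⟨k, hk⟩ := hne
  have hmem : ∀ n : ℕ, k + (n : Fin m) ∈ B := by
    intro n
    induction n with
    | zero => simpa using hk
    | succ n ih => simpa [add_assoc] using hB _ ih
  refine Finset.eq_univ_of_forall fun x => ?_
  simpa using hmem (x - k).val

/-- With `𝔞_{π,σ⃗}(B) = log_N |A_{π,σ⃗}(B)| − |B| + ½|B²|_π − 1` and
`𝔞_{π,σ⃗} = log_N |A_{π,σ⃗}| − (m/2 + 1)`: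
for `k ∈ B`, `𝔞(B ∪ {k−1}) ≤ 𝔞(B)` and `𝔞(B ∪ {k+1}) ≤ 𝔞(B)` (cyclically in `[m]`), and in
particular `𝔞(B) ≥ 𝔞` for every nonempty `B ⊆ [m]`.  All inequalities are stated in the
equivalent form between cardinalities multiplied by the corresponding powers of `N`. -/
theorem afrak_union_succ_pred_le_and_ge_global
    (N m : ℕ) (hN : 0 < N) [NeZero m] (hm : Even m)
    (π : Equiv.Perm (Fin m)) (hπinv : ∀ k, π (π k) = k) (hπfix : ∀ k, π k ≠ k)
    (σv : Fin m → Equiv.Perm (Fin N × Fin N)) :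
    (∀ B : Finset (Fin m), ∀ k ∈ B,
      ((Ares N m π σv (B ∪ {k - 1})).card * N ^ (B.card + cpair m π (B ∪ {k - 1}) / 2)
        ≤ (Ares N m π σv B).card * N ^ ((B ∪ {k - 1}).card + cpair m π B / 2)) ∧
      ((Ares N m π σv (B ∪ {k + 1})).card * N ^ (B.card + cpair m π (B ∪ {k + 1}) / 2)
        ≤ (Ares N m π σv B).card * N ^ ((B ∪ {k + 1}).card + cpair m π B / 2)))
    ∧ (∀ B : Finset (Fin m), B.Nonempty →
        (Afull N m π σv).card * N ^ B.card
          ≤ (Ares N m π σv B).card * N ^ (m / 2 + cpair m π B / 2)) := by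
  have hstep : ∀ B : Finset (Fin m), ∀ k ∈ B,
      ((Ares N m π σv (B ∪ {k - 1})).card * N ^ (B.card + cpair m π (B ∪ {k - 1}) / 2)
        ≤ (Ares N m π σv B).card * N ^ ((B ∪ {k - 1}).card + cpair m π B / 2)) ∧
      ((Ares N m π σv (B ∪ {k + 1})).card * N ^ (B.card + cpair m π (B ∪ {k + 1}) / 2)
        ≤ (Ares N m π σv B).card * N ^ ((B ∪ {k + 1}).card + cpair m π B / 2)) := by
    intro B k hk
    rw [Finset.union_singleton, Finset.union_singleton]
    constructor
    · refine card_Ares_insert_mul_pow_le hπinv hπfix (fun v => (v (k - 1)).1)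
        fun v hv w hw hB hh => Prod.ext hh ?_
      rw [(Finset.mem_filter.1 hv).2.1, (Finset.mem_filter.1 hw).2.1, sub_add_cancel, hB k hk]
    · refine card_Ares_insert_mul_pow_le hπinv hπfix (fun v => (v (k + 1)).2)
        fun v hv w hw hB hh => Prod.ext ?_ hh
      rw [← (Finset.mem_filter.1 hv).2.1, ← (Finset.mem_filter.1 hw).2.1, hB k hk]
  refine ⟨hstep, fun B => ?_⟩
  induction hn : Bᶜ.card using Nat.strong_induction_on generalizing B with | _ n ih
  intro hne
  by_cases huniv : B = Finset.univ
  · subst huniv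
    rw [card_Ares_univ, cpair_univ, Finset.card_univ, Fintype.card_fin,
      show m / 2 + m / 2 = m by have := Nat.two_mul_div_two_of_even hm; omega]
  obtain ⟨k, hk, hk1⟩ : ∃ k ∈ B, k + 1 ∉ B := by
    by_contra! hcon
    exact huniv (Fin.eq_univ_of_add_one_mem hne hcon)
  set C := B ∪ {k + 1}
  have hlt : Cᶜ.card < n := by
    rw [← hn]
    refine Finset.card_lt_card (Finset.compl_ssubset_compl.2 ?_)
    simpa [C] using Finset.ssubset_insert hk1
  have hC := ih _ hlt C rfl (hne.mono Finset.subset_union_left)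
  have hBC := (hstep B k hk).2
  refine Nat.le_of_mul_le_mul_right ?_ (pow_pos hN C.card)
  calc (Afull N m π σv).card * N ^ B.card * N ^ C.card
      = (Afull N m π σv).card * N ^ C.card * N ^ B.card := by ring
    _ ≤ (Ares N m π σv C).card * N ^ (m / 2 + cpair m π C / 2) * N ^ B.card :=
        Nat.mul_le_mul_right _ hC
    _ = (Ares N m π σv C).card * N ^ (B.card + cpair m π C / 2) * N ^ (m / 2) := by ring
    _ ≤ (Ares N m π σv B).card * N ^ (C.card + cpair m π B / 2) * N ^ (m / 2) :=
        Nat.mul_le_mul_right _ hBC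
    _ = (Ares N m π σv B).card * N ^ (m / 2 + cpair m π B / 2) * N ^ C.card := by ring
end

section
/- Fix N, a positive even integer m, π ∈ P₂(m) and σ⃗ = (σ_1,…,σ_m) ∈ S([N]²)^m. If B ⊆ [m] and k ∈ B, then 𝔞_{π,σ⃗}(B ∪ {π(k)}) ≤ 𝔞_{π,σ⃗}(B). -/
open Finset

/-- The index pair at `π k` is determined by the one at `k`, so restricting to `B` is injective. -/
theorem card_Ares_union_partner_le (N m : ℕ) [NeZero m] (π : Equiv.Perm (Fin m))
    (σv : Fin m → Equiv.Perm (Fin N × Fin N)) (B : Finset (Fin m)) {k : Fin m} (hk : k ∈ B) :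
    (Ares N m π σv (B ∪ {π k})).card ≤ (Ares N m π σv B).card := by
  refine Finset.card_le_card_of_injOn
    (fun w x => w ⟨x.1, Finset.mem_union_left _ x.2⟩) ?_ ?_
  · intro w hw
    obtain ⟨v, hv, rfl⟩ := Finset.mem_image.1 hw
    exact Finset.mem_image.2 ⟨v, hv, rfl⟩
  · intro w hw w' hw' h
    obtain ⟨v, hv, rfl⟩ := Finset.mem_image.1 hw
    obtain ⟨v', hv', rfl⟩ := Finset.mem_image.1 hw'
    have hB : ∀ x ∈ B, v x = v' x := fun x hx => congrFun h ⟨x, hx⟩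
    have hv₂ := (Finset.mem_filter.1 hv).2.2 k
    have hv₂' := (Finset.mem_filter.1 hv').2.2 k
    rw [hB k hk, hv₂'] at hv₂
    funext ⟨x, hx⟩
    rcases Finset.mem_union.1 hx with hx | hx
    · exact hB x hx
    · obtain rfl := Finset.mem_singleton.1 hx
      exact ((σv (π k)).injective (Prod.swap_injective hv₂)).symm

theorem cpair_union_partner_le (m : ℕ) (π : Equiv.Perm (Fin m)) (hπinv : ∀ k, π (π k) = k)
    (B : Finset (Fin m)) (k : Fin m) :
    cpair m π (B ∪ {π k}) ≤ cpair m π B + 2 := by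
  unfold cpair
  refine (Finset.card_le_card (t := _ ∪ {(k, π k), (π k, k)}) ?_).trans
    ((Finset.card_union_le _ _).trans (Nat.add_le_add_left Finset.card_le_two _))
  rintro ⟨a, b⟩ h
  simp only [mem_filter, mem_univ, true_and, mem_union, mem_insert, mem_singleton,
    Prod.mk.injEq] at h ⊢
  obtain ⟨ha, hb, rfl⟩ := h
  rcases ha with ha | rfl
  · rcases hb with hb | hb
    · exact Or.inl ⟨ha, hb, rfl⟩
    · exact Or.inr (Or.inl ⟨π.injective hb, hb⟩)
  · exact Or.inr (Or.inr ⟨rfl, hπinv k⟩)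

/-- With `𝔞_{π,σ⃗}(B) = log_N |A_{π,σ⃗}(B)| − |B| + ½|B²|_π − 1`:
if `k ∈ B` then `𝔞_{π,σ⃗}(B ∪ {π k}) ≤ 𝔞_{π,σ⃗}(B)`, stated in the equivalent form between
cardinalities multiplied by the corresponding powers of `N`. -/
theorem afrak_union_partner_le
    (N m : ℕ) (hN : 0 < N) [NeZero m] (hm : Even m)
    (π : Equiv.Perm (Fin m)) (hπinv : ∀ k, π (π k) = k) (hπfix : ∀ k, π k ≠ k)
    (σv : Fin m → Equiv.Perm (Fin N × Fin N)) :
    ∀ B : Finset (Fin m), ∀ k ∈ B,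
      (Ares N m π σv (B ∪ {π k})).card * N ^ (B.card + cpair m π (B ∪ {π k}) / 2)
        ≤ (Ares N m π σv B).card * N ^ ((B ∪ {π k}).card + cpair m π B / 2) := by
  intro B k hk
  by_cases hπk : π k ∈ B
  · rw [Finset.union_eq_left.2 (Finset.singleton_subset_iff.2 hπk)]
  · have hcard : (B ∪ {π k}).card = B.card + 1 := by
      rw [Finset.card_union_of_disjoint (Finset.disjoint_singleton_right.2 hπk),
        Finset.card_singleton]
    have hpair := cpair_union_partner_le m π hπinv B k
    exact Nat.mul_le_mul (card_Ares_union_partner_le N m π σv B hk)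
      (Nat.pow_le_pow_right hN (by omega))
end

section
/- Fix N, a positive even integer m, π ∈ P₂(m) and σ⃗ = (σ_1,…,σ_m) ∈ S([N]²)^m. If B ⊆ [m], k ∈ [m] satisfy {k, π(k)} ∩ B = ∅ and {k−1, k+1} ⊆ B (cyclically in [m]), then 𝔞_{π,σ⃗}(B ∪ {k}) ≤ 𝔞_{π,σ⃗}(B) − 1. -/
open Finset

/-- Adding a point `k` whose partner lies outside `B` creates no new matched pair. -/
theorem cpair_union_singleton {m : ℕ} {π : Equiv.Perm (Fin m)} (hπinv : ∀ k, π (π k) = k)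
    (hπfix : ∀ k, π k ≠ k) {B : Finset (Fin m)} {k : Fin m} (hk : k ∉ B) (hπk : π k ∉ B) :
    cpair m π (B ∪ {k}) = cpair m π B := by
  unfold cpair
  congr 1
  ext ⟨a, b⟩
  simp only [mem_filter, mem_univ, true_and, mem_union, mem_singleton]
  constructor
  · rintro ⟨ha | rfl, hb | rfl, h⟩
    · exact ⟨ha, hb, h⟩
    · exact absurd (by rwa [← h, hπinv]) hπk
    · exact absurd (h ▸ hb) hπk
    · exact absurd h (hπfix _)
  · rintro ⟨ha, hb, h⟩
    exact ⟨Or.inl ha, Or.inl hb, h⟩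

/-- The entry of an admissible tuple at `k` is determined by its entries at `k - 1`
and `k + 1`. -/
theorem apply_eq_of_mem_Afull {N m : ℕ} [NeZero m] {π : Equiv.Perm (Fin m)}
    {σv : Fin m → Equiv.Perm (Fin N × Fin N)} {v : Fin m → Fin N × Fin N}
    (hv : v ∈ Afull N m π σv) (k : Fin m) : v k = ((v (k - 1)).2, (v (k + 1)).1) := by
  have h := (mem_filter.mp hv).2.1
  refine Prod.ext ?_ (h k)
  simpa using (h (k - 1)).symm

/-- A partial tuple on `B ∪ {k}` is determined by its restriction to `B` as soon as `B` contains
both neighbours of `k`. -/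
theorem card_Ares_union_middle_le {N m : ℕ} [NeZero m] (π : Equiv.Perm (Fin m))
    (σv : Fin m → Equiv.Perm (Fin N × Fin N)) {B : Finset (Fin m)} {k : Fin m}
    (hpred : k - 1 ∈ B) (hsucc : k + 1 ∈ B) :
    (Ares N m π σv (B ∪ {k})).card ≤ (Ares N m π σv B).card := by
  refine Finset.card_le_card_of_injOn (fun w s => w ⟨s.1, mem_union_left _ s.2⟩) ?_ ?_
  · intro w hw
    obtain ⟨v, hv, rfl⟩ := mem_image.mp hw
    exact mem_image_of_mem _ hv
  · intro w hw w' hw' heq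
    obtain ⟨v, hv, rfl⟩ := mem_image.mp hw
    obtain ⟨v', hv', rfl⟩ := mem_image.mp hw'
    have hB : ∀ s ∈ B, v s = v' s := fun s hs => congrFun heq ⟨s, hs⟩
    funext ⟨s, hs⟩
    rcases mem_union.mp hs with hs | hs
    · exact hB s hs
    · obtain rfl := mem_singleton.mp hs
      change v s = v' s
      rw [apply_eq_of_mem_Afull hv, apply_eq_of_mem_Afull hv', hB _ hpred, hB _ hsucc]


/-- With `𝔞_{π,σ⃗}(B) = log_N |A_{π,σ⃗}(B)| − |B| + ½|B²|_π − 1`: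
if `{k, π k} ∩ B = ∅` and `{k−1, k+1} ⊆ B` (cyclically in `[m]`), then
`𝔞_{π,σ⃗}(B ∪ {k}) ≤ 𝔞_{π,σ⃗}(B) − 1`, stated in the equivalent form between cardinalities
multiplied by the corresponding powers of `N`. -/
theorem afrak_union_middle_le_sub_one
    (N m : ℕ) (hN : 0 < N) [NeZero m] (hm : Even m)
    (π : Equiv.Perm (Fin m)) (hπinv : ∀ k, π (π k) = k) (hπfix : ∀ k, π k ≠ k)
    (σv : Fin m → Equiv.Perm (Fin N × Fin N)) :
    ∀ (B : Finset (Fin m)) (k : Fin m), k ∉ B → π k ∉ B → k - 1 ∈ B → k + 1 ∈ B →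
      (Ares N m π σv (B ∪ {k})).card * N ^ (B.card + cpair m π (B ∪ {k}) / 2 + 1)
        ≤ (Ares N m π σv B).card * N ^ ((B ∪ {k}).card + cpair m π B / 2) := by
  intro B k hk hπk hpred hsucc
  rw [cpair_union_singleton hπinv hπfix hk hπk, Finset.union_comm B {k}, ← Finset.insert_eq,
    Finset.card_insert_of_notMem hk, Finset.insert_eq, Finset.union_comm {k} B, add_right_comm]
  exact Nat.mul_le_mul_right _ (card_Ares_union_middle_le π σv hpred hsucc)
end

section
/- Let N be a positive integer and let σ_1, σ_2, σ_3, σ_4 ∈ S([N]²) each be either the identity or the transpose ⊤. Then the cardinality C_1 = |{(i,j,k,l) ∈ [N]⁴ : σ_1(i,j) = ⊤(σ_3(k,l)) and σ_2(j,k) = ⊤(σ_4(l,i))}| equals N² if σ_1 ≠ σ_3 and σ_2 ≠ σ_4, and equals N otherwise. -/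
/-- The transpose permutation `⊤ : (i,j) ↦ (j,i)` of `[N]²`. -/
def transposePerm (N : ℕ) : Equiv.Perm (Fin N × Fin N) :=
  Equiv.prodComm (Fin N) (Fin N)

theorem apply_eq_swap_apply_iff_of_eq {N : ℕ} {σ : Equiv.Perm (Fin N × Fin N)}
    (hσ : σ = 1 ∨ σ = transposePerm N) (a b c d : Fin N) :
    σ (a, b) = Prod.swap (σ (c, d)) ↔ a = d ∧ b = c := by
  rcases hσ with rfl | rfl <;> simp [transposePerm, and_comm]

theorem apply_eq_swap_apply_iff_of_ne {N : ℕ} {σ τ : Equiv.Perm (Fin N × Fin N)}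
    (hσ : σ = 1 ∨ σ = transposePerm N) (hτ : τ = 1 ∨ τ = transposePerm N) (hne : σ ≠ τ)
    (a b c d : Fin N) :
    σ (a, b) = Prod.swap (τ (c, d)) ↔ a = c ∧ b = d := by
  rcases hσ with rfl | rfl <;> rcases hτ with rfl | rfl
  · exact absurd rfl hne
  · simp [transposePerm]
  · simp [transposePerm, and_comm]
  · exact absurd rfl hne

theorem card_eq_of_forall_mem_iff_diagonal {N : ℕ}
    {s : Finset (Fin N × Fin N × Fin N × Fin N)}
    (hs : ∀ i j k l, (i, j, k, l) ∈ s ↔ i = j ∧ i = k ∧ i = l) : s.card = N := by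
  have himage : s = Finset.univ.image (fun i : Fin N => (i, i, i, i)) := by
    ext ⟨i, j, k, l⟩
    rw [hs]
    simp
  rw [himage, Finset.card_image_of_injective _ (fun i j h => congrArg Prod.fst h)]
  simp

theorem card_eq_sq_of_forall_mem_iff {N : ℕ}
    {s : Finset (Fin N × Fin N × Fin N × Fin N)}
    (hs : ∀ i j k l, (i, j, k, l) ∈ s ↔ i = k ∧ j = l) : s.card = N ^ 2 := by
  have himage : s = Finset.univ.image (fun p : Fin N × Fin N => (p.1, p.2, p.1, p.2)) := by
    ext ⟨i, j, k, l⟩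
    rw [hs]
    simp [eq_comm]
  rw [himage, Finset.card_image_of_injective]
  · simp [sq]
  · rintro ⟨a, b⟩ ⟨c, d⟩ h
    simp_all

open scoped Classical in
/-- For `σ₁, σ₂, σ₃, σ₄ ∈ S([N]²)` each either the identity or the
transpose `⊤`, the number of `(i,j,k,l) ∈ [N]⁴` with `σ₁(i,j) = ⊤(σ₃(k,l))` and
`σ₂(j,k) = ⊤(σ₄(l,i))` equals `N²` if `σ₁ ≠ σ₃` and `σ₂ ≠ σ₄`, and equals `N` otherwise. -/
theorem count_four_tuples_id_or_transpose
    (N : ℕ) (hN : 0 < N)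
    (σ₁ σ₂ σ₃ σ₄ : Equiv.Perm (Fin N × Fin N))
    (h₁ : σ₁ = 1 ∨ σ₁ = transposePerm N)
    (h₂ : σ₂ = 1 ∨ σ₂ = transposePerm N)
    (h₃ : σ₃ = 1 ∨ σ₃ = transposePerm N)
    (h₄ : σ₄ = 1 ∨ σ₄ = transposePerm N) :
    (Finset.univ.filter (fun t : Fin N × Fin N × Fin N × Fin N =>
        σ₁ (t.1, t.2.1) = Prod.swap (σ₃ (t.2.2.1, t.2.2.2)) ∧
        σ₂ (t.2.1, t.2.2.1) = Prod.swap (σ₄ (t.2.2.2, t.1)))).card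
      = if σ₁ ≠ σ₃ ∧ σ₂ ≠ σ₄ then N ^ 2 else N := by
  split_ifs with h
  · refine card_eq_sq_of_forall_mem_iff fun i j k l => ?_
    simp only [Finset.mem_filter_univ, apply_eq_swap_apply_iff_of_ne h₁ h₃ h.1,
      apply_eq_swap_apply_iff_of_ne h₂ h₄ h.2]
    grind
  · refine card_eq_of_forall_mem_iff_diagonal fun i j k l => ?_
    rw [Finset.mem_filter_univ]
    by_cases h₁₃ : σ₁ = σ₃
    · subst h₁₃
      rw [apply_eq_swap_apply_iff_of_eq h₁]
      by_cases h₂₄ : σ₂ = σ₄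
      · subst h₂₄
        rw [apply_eq_swap_apply_iff_of_eq h₂]
        grind
      · rw [apply_eq_swap_apply_iff_of_ne h₂ h₄ h₂₄]
        grind
    · obtain rfl : σ₂ = σ₄ := by tauto
      rw [apply_eq_swap_apply_iff_of_ne h₁ h₃ h₁₃, apply_eq_swap_apply_iff_of_eq h₂]
      grind
end

section
/- Let N be a positive integer and let σ_1, σ_2, σ_3, σ_4 ∈ S([N]²) each be either the identity or the transpose ⊤. Then the cardinality C_2 = |{(i,j,k,l,a,b) ∈ [N]⁶ : σ_1(i,j) = ⊤(σ_3(k,l)) and σ_2(a,k) = ⊤(σ_4(b,i))}| equals N³ if σ_1 ≠ σ_3 and σ_2 ≠ σ_4, and equals N² otherwise. -/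
/-- If `σ` is the identity or the transpose, then `σ p = ⊤ (σ q)` says that `p` is the transpose
of `q`. -/
theorem apply_eq_swap_self_iff {N : ℕ} {σ : Equiv.Perm (Fin N × Fin N)}
    (hσ : σ = 1 ∨ σ = transposePerm N) (p q : Fin N × Fin N) :
    σ p = Prod.swap (σ q) ↔ p.1 = q.2 ∧ p.2 = q.1 := by
  rcases hσ with rfl | rfl <;> simp [transposePerm, Prod.ext_iff, and_comm]

/-- If one of `σ` and `τ` is the identity and the other is a different permutation, the transpose,
then `σ p = ⊤ (τ q)` says that `p = q`. -/
theorem apply_eq_swap_iff_of_ne {N : ℕ} {σ τ : Equiv.Perm (Fin N × Fin N)}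
    (hσ : σ = 1 ∨ σ = transposePerm N) (hτ : τ = 1 ∨ τ = transposePerm N) (hne : σ ≠ τ)
    (p q : Fin N × Fin N) :
    σ p = Prod.swap (τ q) ↔ p.1 = q.1 ∧ p.2 = q.2 := by
  rcases hσ with rfl | rfl <;> rcases hτ with rfl | rfl
  · exact absurd rfl hne
  · simp [transposePerm, Prod.ext_iff]
  · simp [transposePerm, Prod.ext_iff, and_comm]
  · exact absurd rfl hne

/-- A predicate that cuts out the range of an injective map holds for as many elements as the
domain of the map has. -/
theorem card_filter_eq_card_of_injective {α β : Type*} [Fintype α] [Fintype β]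
    (p : β → Prop) [DecidablePred p] (f : α → β) (hf : Function.Injective f)
    (hp : ∀ b, p b ↔ ∃ a, f a = b) :
    (Finset.univ.filter p).card = Fintype.card α := by
  classical
  rw [← Finset.card_univ, ← Finset.card_image_of_injective _ hf]
  congr 1
  ext b
  simp [hp]

open scoped Classical in
/-- For `σ₁, σ₂, σ₃, σ₄ ∈ S([N]²)` each either the identity or the
transpose `⊤`, the number of `(i,j,k,l,a,b) ∈ [N]⁶` with `σ₁(i,j) = ⊤(σ₃(k,l))` and
`σ₂(a,k) = ⊤(σ₄(b,i))` equals `N³` if `σ₁ ≠ σ₃` and `σ₂ ≠ σ₄`, and equals `N²` otherwise. -/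
theorem count_six_tuples_id_or_transpose
    (N : ℕ) (hN : 0 < N)
    (σ₁ σ₂ σ₃ σ₄ : Equiv.Perm (Fin N × Fin N))
    (h₁ : σ₁ = 1 ∨ σ₁ = transposePerm N)
    (h₂ : σ₂ = 1 ∨ σ₂ = transposePerm N)
    (h₃ : σ₃ = 1 ∨ σ₃ = transposePerm N)
    (h₄ : σ₄ = 1 ∨ σ₄ = transposePerm N) :
    (Finset.univ.filter
        (fun t : Fin N × Fin N × Fin N × Fin N × Fin N × Fin N =>
        σ₁ (t.1, t.2.1) = Prod.swap (σ₃ (t.2.2.1, t.2.2.2.1)) ∧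
        σ₂ (t.2.2.2.2.1, t.2.2.1) = Prod.swap (σ₄ (t.2.2.2.2.2, t.1)))).card
      = if σ₁ ≠ σ₃ ∧ σ₂ ≠ σ₄ then N ^ 3 else N ^ 2 := by
  by_cases h₁₃ : σ₁ = σ₃ <;> by_cases h₂₄ : σ₂ = σ₄
  · subst h₁₃ h₂₄
    rw [card_filter_eq_card_of_injective _
      (fun x : Fin N × Fin N => (x.1, x.2, x.2, x.1, x.1, x.2))]
    · simp [sq]
    · intro x y h
      simp only [Prod.mk.injEq] at h
      grind
    · rintro ⟨i, j, k, l, a, b⟩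
      simp only [apply_eq_swap_self_iff h₁, apply_eq_swap_self_iff h₂,
        Prod.mk.injEq, Prod.exists]
      grind
  · subst h₁₃
    rw [card_filter_eq_card_of_injective _
      (fun x : Fin N × Fin N => (x.1, x.1, x.1, x.1, x.2, x.2))]
    · simp [h₂₄, sq]
    · intro x y h
      simp only [Prod.mk.injEq] at h
      grind
    · rintro ⟨i, j, k, l, a, b⟩
      simp only [apply_eq_swap_self_iff h₁, apply_eq_swap_iff_of_ne h₂ h₄ h₂₄,
        Prod.mk.injEq, Prod.exists]
      grind
  · subst h₂₄
    rw [card_filter_eq_card_of_injective _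
      (fun x : Fin N × Fin N => (x.1, x.2, x.1, x.2, x.1, x.1))]
    · simp [h₁₃, sq]
    · intro x y h
      simp only [Prod.mk.injEq] at h
      grind
    · rintro ⟨i, j, k, l, a, b⟩
      simp only [apply_eq_swap_iff_of_ne h₁ h₃ h₁₃, apply_eq_swap_self_iff h₂,
        Prod.mk.injEq, Prod.exists]
      grind
  · rw [card_filter_eq_card_of_injective _
      (fun x : Fin N × Fin N × Fin N => (x.1, x.2.1, x.1, x.2.1, x.2.2, x.2.2))]
    · simp [h₁₃, h₂₄, pow_succ, mul_assoc]
    · intro x y h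
      simp only [Prod.mk.injEq] at h
      grind
    · rintro ⟨i, j, k, l, a, b⟩
      simp only [apply_eq_swap_iff_of_ne h₁ h₃ h₁₃, apply_eq_swap_iff_of_ne h₂ h₄ h₂₄,
        Prod.mk.injEq, Prod.exists]
      grind
end
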